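/- arXiv:2006.15867 — 2 statements merged into one kernel-verified Lean document; each statement's English description precedes it below -/
import Mathlib

section
/- Let T be an invertible block TBT-matrix and ℒ̂ = col[ℒ₂; 0; −ℒ₁; 0]. Then ℒ̂^* Γ̂ = 0, where Γ̂ = col[Γ̂₁; Γ̂₂]; consequently, for λ = (λ₁,λ₂) with λ₁,λ₂ ≠ i/2, one has ℒ̂^* û(λ) = 0, where û(λ) = col[û₁(λ); û₂(λ)]. -/
open Matrix Kronecker BigOperators

noncomputable section

namespace TBT

/-- The entries `a_r` of the matrices `𝒜_p`. -/
def aEnt (r : ℤ) : ℂ := if r < 0 then 0 else if r = 0 then Complex.I / 2 else Complex.I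

/-- The `n × n` matrix `𝒜 = {a_{j-ℓ}}`. -/
def calA (n : ℕ) : Matrix (Fin n) (Fin n) ℂ :=
  Matrix.of fun j ℓ => aEnt (((j : ℕ) : ℤ) - ((ℓ : ℕ) : ℤ))

/-- The index type of the `m × m` matrices, `m = m₁ m₂ m₃`. -/
abbrev Idx (m₁ m₂ m₃ : ℕ) := (Fin m₁ × Fin m₂) × Fin m₃

/-- `A₁ = 𝒜₁ ⊗ I_{m₂} ⊗ I_{m₃}`. -/
def A1 (m₁ m₂ m₃ : ℕ) : Matrix (Idx m₁ m₂ m₃) (Idx m₁ m₂ m₃) ℂ :=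
  (calA m₁ ⊗ₖ (1 : Matrix (Fin m₂) (Fin m₂) ℂ)) ⊗ₖ (1 : Matrix (Fin m₃) (Fin m₃) ℂ)

/-- `A₂ = I_{m₁} ⊗ 𝒜₂ ⊗ I_{m₃}`. -/
def A2 (m₁ m₂ m₃ : ℕ) : Matrix (Idx m₁ m₂ m₃) (Idx m₁ m₂ m₃) ℂ :=
  ((1 : Matrix (Fin m₁) (Fin m₁) ℂ) ⊗ₖ calA m₂) ⊗ₖ (1 : Matrix (Fin m₃) (Fin m₃) ℂ)

/-- `A₃ = I_{m₁} ⊗ I_{m₂} ⊗ 𝒜₃`. -/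
def A3 (m₁ m₂ m₃ : ℕ) : Matrix (Idx m₁ m₂ m₃) (Idx m₁ m₂ m₃) ℂ :=
  ((1 : Matrix (Fin m₁) (Fin m₁) ℂ) ⊗ₖ (1 : Matrix (Fin m₂) (Fin m₂) ℂ)) ⊗ₖ calA m₃

/-- The block TBT-matrix `T = {𝒯_{i-k}}`, `𝒯_r = {t^{(r)}_{i-k}}`, built from the
data `t : ℤ → ℤ → Matrix (Fin m₃) (Fin m₃) ℂ` of its `m₃ × m₃` blocks. -/
def Tmat (m₁ m₂ m₃ : ℕ) (t : ℤ → ℤ → Matrix (Fin m₃) (Fin m₃) ℂ) :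
    Matrix (Idx m₁ m₂ m₃) (Idx m₁ m₂ m₃) ℂ :=
  Matrix.of fun x y =>
    t (((x.1.1 : ℕ) : ℤ) - ((y.1.1 : ℕ) : ℤ)) (((x.1.2 : ℕ) : ℤ) - ((y.1.2 : ℕ) : ℤ)) x.2 y.2

/-- The Toeplitz blocks `𝒯_r = {t^{(r)}_{i-k}}` of a block TBT-matrix. -/
def calT (m₂ m₃ : ℕ) (t : ℤ → ℤ → Matrix (Fin m₃) (Fin m₃) ℂ) (r : ℤ) :
    Matrix (Fin m₂ × Fin m₃) (Fin m₂ × Fin m₃) ℂ :=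
  Matrix.of fun x y => t r (((x.1 : ℕ) : ℤ) - ((y.1 : ℕ) : ℤ)) x.2 y.2

/-- `M₁₁ = col [M₁₁⁽¹⁾ … M₁₁⁽ᵐ¹⁾]`, `M₁₁⁽ⁱ⁾ = (1/2)𝒯₀ + Σ_{s=1}^{i-1} 𝒯_s`. -/
def M11 (m₁ m₂ m₃ : ℕ) (t : ℤ → ℤ → Matrix (Fin m₃) (Fin m₃) ℂ) :
    Matrix (Idx m₁ m₂ m₃) (Fin m₂ × Fin m₃) ℂ :=
  Matrix.of fun x y =>
    ((2 : ℂ)⁻¹ • calT m₂ m₃ t 0 +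
      ∑ s ∈ Finset.range (x.1.1 : ℕ), calT m₂ m₃ t ((s : ℤ) + 1)) (x.1.2, x.2) y

/-- `M₂₁ = 1_{m₁}^* ⊗ I_{m₂ m₃}`. -/
def M21 (m₁ m₂ m₃ : ℕ) : Matrix (Fin m₂ × Fin m₃) (Idx m₁ m₂ m₃) ℂ :=
  Matrix.of fun y x => if y.1 = x.1.2 ∧ y.2 = x.2 then 1 else 0

/-- `M₃₁ = M₂₁^*`. -/
def M31 (m₁ m₂ m₃ : ℕ) : Matrix (Idx m₁ m₂ m₃) (Fin m₂ × Fin m₃) ℂ := (M21 m₁ m₂ m₃)ᴴ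

/-- `M₄₁ = [M₄₁⁽¹⁾ … M₄₁⁽ᵐ¹⁾]`, `M₄₁⁽ᵏ⁾ = (1/2)𝒯₀ + Σ_{s=1}^{k-1} 𝒯_{-s}`. -/
def M41 (m₁ m₂ m₃ : ℕ) (t : ℤ → ℤ → Matrix (Fin m₃) (Fin m₃) ℂ) :
    Matrix (Fin m₂ × Fin m₃) (Idx m₁ m₂ m₃) ℂ :=
  Matrix.of fun y x =>
    ((2 : ℂ)⁻¹ • calT m₂ m₃ t 0 +
      ∑ s ∈ Finset.range (x.1.1 : ℕ), calT m₂ m₃ t (-((s : ℤ) + 1))) y (x.1.2, x.2)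

/-- The blocks `M₁₂⁽ʳ⁾ = col [(1/2)t₀⁽ʳ⁾, (1/2)t₀⁽ʳ⁾ + t₁⁽ʳ⁾, …]`. -/
def M12blk (m₂ m₃ : ℕ) (t : ℤ → ℤ → Matrix (Fin m₃) (Fin m₃) ℂ) (r : ℤ) :
    Matrix (Fin m₂ × Fin m₃) (Fin m₃) ℂ :=
  Matrix.of fun x l =>
    ((2 : ℂ)⁻¹ • t r 0 + ∑ j ∈ Finset.range (x.1 : ℕ), t r ((j : ℤ) + 1)) x.2 l

/-- `M₁₂ = {M₁₂^{(i-k)}}_{i,k=1}^{m₁}`. -/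
def M12 (m₁ m₂ m₃ : ℕ) (t : ℤ → ℤ → Matrix (Fin m₃) (Fin m₃) ℂ) :
    Matrix (Idx m₁ m₂ m₃) (Fin m₁ × Fin m₃) ℂ :=
  Matrix.of fun x y => M12blk m₂ m₃ t (((x.1.1 : ℕ) : ℤ) - ((y.1 : ℕ) : ℤ)) (x.1.2, x.2) y.2

/-- `M₂₂ = I_{m₁} ⊗ 1_{m₂}^* ⊗ I_{m₃}`. -/
def M22 (m₁ m₂ m₃ : ℕ) : Matrix (Fin m₁ × Fin m₃) (Idx m₁ m₂ m₃) ℂ :=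
  Matrix.of fun y x => if y.1 = x.1.1 ∧ y.2 = x.2 then 1 else 0

/-- `M₃₂ = M₂₂^*`. -/
def M32 (m₁ m₂ m₃ : ℕ) : Matrix (Idx m₁ m₂ m₃) (Fin m₁ × Fin m₃) ℂ := (M22 m₁ m₂ m₃)ᴴ

/-- The blocks `M₄₂⁽ʳ⁾ = [(1/2)t₀⁽ʳ⁾, (1/2)t₀⁽ʳ⁾ + t₋₁⁽ʳ⁾, …]`. -/
def M42blk (m₂ m₃ : ℕ) (t : ℤ → ℤ → Matrix (Fin m₃) (Fin m₃) ℂ) (r : ℤ) :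
    Matrix (Fin m₃) (Fin m₂ × Fin m₃) ℂ :=
  Matrix.of fun l x =>
    ((2 : ℂ)⁻¹ • t r 0 + ∑ j ∈ Finset.range (x.1 : ℕ), t r (-((j : ℤ) + 1))) l x.2

/-- `M₄₂ = {M₄₂^{(i-k)}}_{i,k=1}^{m₁}`. -/
def M42 (m₁ m₂ m₃ : ℕ) (t : ℤ → ℤ → Matrix (Fin m₃) (Fin m₃) ℂ) :
    Matrix (Fin m₁ × Fin m₃) (Idx m₁ m₂ m₃) ℂ :=
  Matrix.of fun y x => M42blk m₂ m₃ t (((y.1 : ℕ) : ℤ) - ((x.1.1 : ℕ) : ℤ)) y.2 (x.1.2, x.2)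

/-- `Π₁ = [M₁₁ M₃₁]`. -/
def Pi1 (m₁ m₂ m₃ : ℕ) (t : ℤ → ℤ → Matrix (Fin m₃) (Fin m₃) ℂ) :
    Matrix (Idx m₁ m₂ m₃) ((Fin m₂ × Fin m₃) ⊕ (Fin m₂ × Fin m₃)) ℂ :=
  Matrix.fromCols (M11 m₁ m₂ m₃ t) (M31 m₁ m₂ m₃)

/-- `Π₂ = [M₁₂ M₃₂]`. -/
def Pi2 (m₁ m₂ m₃ : ℕ) (t : ℤ → ℤ → Matrix (Fin m₃) (Fin m₃) ℂ) :
    Matrix (Idx m₁ m₂ m₃) ((Fin m₁ × Fin m₃) ⊕ (Fin m₁ × Fin m₃)) ℂ :=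
  Matrix.fromCols (M12 m₁ m₂ m₃ t) (M32 m₁ m₂ m₃)

/-- `Π̂₁ = col [M₂₁; M₄₁]`. -/
def Pihat1 (m₁ m₂ m₃ : ℕ) (t : ℤ → ℤ → Matrix (Fin m₃) (Fin m₃) ℂ) :
    Matrix ((Fin m₂ × Fin m₃) ⊕ (Fin m₂ × Fin m₃)) (Idx m₁ m₂ m₃) ℂ :=
  Matrix.fromRows (M21 m₁ m₂ m₃) (M41 m₁ m₂ m₃ t)

/-- `Π̂₂ = col [M₂₂; M₄₂]`. -/
def Pihat2 (m₁ m₂ m₃ : ℕ) (t : ℤ → ℤ → Matrix (Fin m₃) (Fin m₃) ℂ) :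
    Matrix ((Fin m₁ × Fin m₃) ⊕ (Fin m₁ × Fin m₃)) (Idx m₁ m₂ m₃) ℂ :=
  Matrix.fromRows (M22 m₁ m₂ m₃) (M42 m₁ m₂ m₃ t)

/-- `Γ₁ = T⁻¹ Π₁`. -/
def Gamma1 (m₁ m₂ m₃ : ℕ) (t : ℤ → ℤ → Matrix (Fin m₃) (Fin m₃) ℂ) :
    Matrix (Idx m₁ m₂ m₃) ((Fin m₂ × Fin m₃) ⊕ (Fin m₂ × Fin m₃)) ℂ :=
  (Tmat m₁ m₂ m₃ t)⁻¹ * Pi1 m₁ m₂ m₃ t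

/-- `Γ₂ = T⁻¹ Π₂`. -/
def Gamma2 (m₁ m₂ m₃ : ℕ) (t : ℤ → ℤ → Matrix (Fin m₃) (Fin m₃) ℂ) :
    Matrix (Idx m₁ m₂ m₃) ((Fin m₁ × Fin m₃) ⊕ (Fin m₁ × Fin m₃)) ℂ :=
  (Tmat m₁ m₂ m₃ t)⁻¹ * Pi2 m₁ m₂ m₃ t

/-- `Γ̂₁ = Π̂₁ T⁻¹`. -/
def Gammahat1 (m₁ m₂ m₃ : ℕ) (t : ℤ → ℤ → Matrix (Fin m₃) (Fin m₃) ℂ) :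
    Matrix ((Fin m₂ × Fin m₃) ⊕ (Fin m₂ × Fin m₃)) (Idx m₁ m₂ m₃) ℂ :=
  Pihat1 m₁ m₂ m₃ t * (Tmat m₁ m₂ m₃ t)⁻¹

/-- `Γ̂₂ = Π̂₂ T⁻¹`. -/
def Gammahat2 (m₁ m₂ m₃ : ℕ) (t : ℤ → ℤ → Matrix (Fin m₃) (Fin m₃) ℂ) :
    Matrix ((Fin m₁ × Fin m₃) ⊕ (Fin m₁ × Fin m₃)) (Idx m₁ m₂ m₃) ℂ :=
  Pihat2 m₁ m₂ m₃ t * (Tmat m₁ m₂ m₃ t)⁻¹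

/-- `ℒ = 1_{m₁m₂} ⊗ I_{m₃}`. -/
def Lmat (m₁ m₂ m₃ : ℕ) : Matrix (Idx m₁ m₂ m₃) (Fin m₃) ℂ :=
  Matrix.of fun x l => if x.2 = l then 1 else 0

/-- `ℒ_p = 1_{m_p} ⊗ I_{m₃}`. -/
def Lp (n m₃ : ℕ) : Matrix (Fin n × Fin m₃) (Fin m₃) ℂ :=
  Matrix.of fun x l => if x.2 = l then 1 else 0

/-- A row vector `v` Kronecker the identity `I_{m₃}`. -/
def rowKronId {n : Type*} (m₃ : ℕ) (v : n → ℂ) : Matrix (Fin m₃) (n × Fin m₃) ℂ :=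
  Matrix.of fun l x => v x.1 * (if l = x.2 then 1 else 0)

/-- A column vector `v` Kronecker the identity `I_{m₃}`. -/
def colKronId {n : Type*} (m₃ : ℕ) (v : n → ℂ) : Matrix (n × Fin m₃) (Fin m₃) ℂ :=
  Matrix.of fun x l => v x.1 * (if x.2 = l then 1 else 0)

/-- `ω(λ,μ) = ℒ^* (A₁^*-μ₁I)⁻¹ (A₂^*-μ₂I)⁻¹ T⁻¹ (A₁-λ₁I)⁻¹ (A₂-λ₂I)⁻¹ ℒ`. -/
def omegaF (m₁ m₂ m₃ : ℕ) (t : ℤ → ℤ → Matrix (Fin m₃) (Fin m₃) ℂ) (l₁ l₂ mu₁ mu₂ : ℂ) :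
    Matrix (Fin m₃) (Fin m₃) ℂ :=
  (Lmat m₁ m₂ m₃)ᴴ * ((A1 m₁ m₂ m₃)ᴴ - mu₁ • 1)⁻¹ * ((A2 m₁ m₂ m₃)ᴴ - mu₂ • 1)⁻¹ *
    (Tmat m₁ m₂ m₃ t)⁻¹ * (A1 m₁ m₂ m₃ - l₁ • 1)⁻¹ * (A2 m₁ m₂ m₃ - l₂ • 1)⁻¹ *
    Lmat m₁ m₂ m₃

/-- `v₁(μ) = ℒ^* (A₁^*-μ₁I)⁻¹ (A₂^*-μ₂I)⁻¹ Γ₁`. -/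
def v1 (m₁ m₂ m₃ : ℕ) (t : ℤ → ℤ → Matrix (Fin m₃) (Fin m₃) ℂ) (mu₁ mu₂ : ℂ) :
    Matrix (Fin m₃) ((Fin m₂ × Fin m₃) ⊕ (Fin m₂ × Fin m₃)) ℂ :=
  (Lmat m₁ m₂ m₃)ᴴ * ((A1 m₁ m₂ m₃)ᴴ - mu₁ • 1)⁻¹ * ((A2 m₁ m₂ m₃)ᴴ - mu₂ • 1)⁻¹ *
    Gamma1 m₁ m₂ m₃ t

/-- `v₂(μ) = ℒ^* (A₁^*-μ₁I)⁻¹ (A₂^*-μ₂I)⁻¹ Γ₂`. -/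
def v2 (m₁ m₂ m₃ : ℕ) (t : ℤ → ℤ → Matrix (Fin m₃) (Fin m₃) ℂ) (mu₁ mu₂ : ℂ) :
    Matrix (Fin m₃) ((Fin m₁ × Fin m₃) ⊕ (Fin m₁ × Fin m₃)) ℂ :=
  (Lmat m₁ m₂ m₃)ᴴ * ((A1 m₁ m₂ m₃)ᴴ - mu₁ • 1)⁻¹ * ((A2 m₁ m₂ m₃)ᴴ - mu₂ • 1)⁻¹ *
    Gamma2 m₁ m₂ m₃ t

/-- `v̂₁(λ) = Γ̂₁ (A₁-λ₁I)⁻¹ (A₂-λ₂I)⁻¹ ℒ`. -/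
def vhat1 (m₁ m₂ m₃ : ℕ) (t : ℤ → ℤ → Matrix (Fin m₃) (Fin m₃) ℂ) (l₁ l₂ : ℂ) :
    Matrix ((Fin m₂ × Fin m₃) ⊕ (Fin m₂ × Fin m₃)) (Fin m₃) ℂ :=
  Gammahat1 m₁ m₂ m₃ t * (A1 m₁ m₂ m₃ - l₁ • 1)⁻¹ * (A2 m₁ m₂ m₃ - l₂ • 1)⁻¹ * Lmat m₁ m₂ m₃

/-- `v̂₂(λ) = Γ̂₂ (A₁-λ₁I)⁻¹ (A₂-λ₂I)⁻¹ ℒ`. -/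
def vhat2 (m₁ m₂ m₃ : ℕ) (t : ℤ → ℤ → Matrix (Fin m₃) (Fin m₃) ℂ) (l₁ l₂ : ℂ) :
    Matrix ((Fin m₁ × Fin m₃) ⊕ (Fin m₁ × Fin m₃)) (Fin m₃) ℂ :=
  Gammahat2 m₁ m₂ m₃ t * (A1 m₁ m₂ m₃ - l₁ • 1)⁻¹ * (A2 m₁ m₂ m₃ - l₂ • 1)⁻¹ * Lmat m₁ m₂ m₃

/-- `u₁(μ) = v₁(μ) - i (1_{m₂}^* (𝒜₂^*-μ₂I)⁻¹ ⊗ I_{m₃}) [I_{m₂m₃} 0]`. -/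
def u1 (m₁ m₂ m₃ : ℕ) (t : ℤ → ℤ → Matrix (Fin m₃) (Fin m₃) ℂ) (mu₁ mu₂ : ℂ) :
    Matrix (Fin m₃) ((Fin m₂ × Fin m₃) ⊕ (Fin m₂ × Fin m₃)) ℂ :=
  v1 m₁ m₂ m₃ t mu₁ mu₂ -
    Complex.I • Matrix.fromCols
      (rowKronId m₃ (Matrix.vecMul (fun _ : Fin m₂ => (1 : ℂ)) (((calA m₂)ᴴ - mu₂ • 1)⁻¹))) 0

/-- `u₂(μ) = v₂(μ) - i (1_{m₁}^* (𝒜₁^*-μ₁I)⁻¹ ⊗ I_{m₃}) [I_{m₁m₃} 0]`. -/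
def u2 (m₁ m₂ m₃ : ℕ) (t : ℤ → ℤ → Matrix (Fin m₃) (Fin m₃) ℂ) (mu₁ mu₂ : ℂ) :
    Matrix (Fin m₃) ((Fin m₁ × Fin m₃) ⊕ (Fin m₁ × Fin m₃)) ℂ :=
  v2 m₁ m₂ m₃ t mu₁ mu₂ -
    Complex.I • Matrix.fromCols
      (rowKronId m₃ (Matrix.vecMul (fun _ : Fin m₁ => (1 : ℂ)) (((calA m₁)ᴴ - mu₁ • 1)⁻¹))) 0

/-- `û₁(λ) = v̂₁(λ) + i col[0; I_{m₂m₃}] ((𝒜₂-λ₂I)⁻¹ 1_{m₂} ⊗ I_{m₃})`. -/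
def uhat1 (m₁ m₂ m₃ : ℕ) (t : ℤ → ℤ → Matrix (Fin m₃) (Fin m₃) ℂ) (l₁ l₂ : ℂ) :
    Matrix ((Fin m₂ × Fin m₃) ⊕ (Fin m₂ × Fin m₃)) (Fin m₃) ℂ :=
  vhat1 m₁ m₂ m₃ t l₁ l₂ +
    Complex.I • Matrix.fromRows 0
      (colKronId m₃ (Matrix.mulVec ((calA m₂ - l₂ • 1)⁻¹) (fun _ : Fin m₂ => (1 : ℂ))))

/-- `û₂(λ) = v̂₂(λ) + i col[0; I_{m₁m₃}] ((𝒜₁-λ₁I)⁻¹ 1_{m₁} ⊗ I_{m₃})`. -/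
def uhat2 (m₁ m₂ m₃ : ℕ) (t : ℤ → ℤ → Matrix (Fin m₃) (Fin m₃) ℂ) (l₁ l₂ : ℂ) :
    Matrix ((Fin m₁ × Fin m₃) ⊕ (Fin m₁ × Fin m₃)) (Fin m₃) ℂ :=
  vhat2 m₁ m₂ m₃ t l₁ l₂ +
    Complex.I • Matrix.fromRows 0
      (colKronId m₃ (Matrix.mulVec ((calA m₁ - l₁ • 1)⁻¹) (fun _ : Fin m₁ => (1 : ℂ))))

/-- `K₁₁ = col [(1/2)M₄₂⁽⁰⁾, (1/2)M₄₂⁽⁰⁾+M₄₂⁽¹⁾, …]`. -/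
def K11 (m₁ m₂ m₃ : ℕ) (t : ℤ → ℤ → Matrix (Fin m₃) (Fin m₃) ℂ) :
    Matrix (Fin m₁ × Fin m₃) (Fin m₂ × Fin m₃) ℂ :=
  Matrix.of fun y x =>
    ((2 : ℂ)⁻¹ • M42blk m₂ m₃ t 0 +
      ∑ j ∈ Finset.range (y.1 : ℕ), M42blk m₂ m₃ t ((j : ℤ) + 1)) y.2 x

/-- `K₁₂ = [(1/2)M₁₂⁽⁰⁾, (1/2)M₁₂⁽⁰⁾+M₁₂⁽⁻¹⁾, …]`. -/
def K12 (m₁ m₂ m₃ : ℕ) (t : ℤ → ℤ → Matrix (Fin m₃) (Fin m₃) ℂ) :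
    Matrix (Fin m₂ × Fin m₃) (Fin m₁ × Fin m₃) ℂ :=
  Matrix.of fun y x =>
    ((2 : ℂ)⁻¹ • M12blk m₂ m₃ t 0 +
      ∑ j ∈ Finset.range (x.1 : ℕ), M12blk m₂ m₃ t (-((j : ℤ) + 1))) y x.2

/-- `K = [(1/2)M₄₂⁽⁰⁾, (1/2)M₄₂⁽⁰⁾+M₄₂⁽⁻¹⁾, …]`. -/
def Kmat (m₁ m₂ m₃ : ℕ) (t : ℤ → ℤ → Matrix (Fin m₃) (Fin m₃) ℂ) :
    Matrix (Fin m₃) (Idx m₁ m₂ m₃) ℂ :=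
  Matrix.of fun l x =>
    ((2 : ℂ)⁻¹ • M42blk m₂ m₃ t 0 +
      ∑ j ∈ Finset.range (x.1.1 : ℕ), M42blk m₂ m₃ t (-((j : ℤ) + 1))) l (x.1.2, x.2)

/-- `N = col [(1/2)M₁₂⁽⁰⁾, (1/2)M₁₂⁽⁰⁾+M₁₂⁽¹⁾, …]`. -/
def Nmat (m₁ m₂ m₃ : ℕ) (t : ℤ → ℤ → Matrix (Fin m₃) (Fin m₃) ℂ) :
    Matrix (Idx m₁ m₂ m₃) (Fin m₃) ℂ :=
  Matrix.of fun x l =>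
    ((2 : ℂ)⁻¹ • M12blk m₂ m₃ t 0 +
      ∑ j ∈ Finset.range (x.1.1 : ℕ), M12blk m₂ m₃ t ((j : ℤ) + 1)) (x.1.2, x.2) l

/-- `diag {(𝒜-zI) ⊗ I_{m₃}, (𝒜-zI) ⊗ I_{m₃}}` (the diagonal blocks `G₁₁`, `G₂₂`). -/
def diagKron (n m₃ : ℕ) (z : ℂ) :
    Matrix ((Fin n × Fin m₃) ⊕ (Fin n × Fin m₃)) ((Fin n × Fin m₃) ⊕ (Fin n × Fin m₃)) ℂ :=
  Matrix.fromBlocks ((calA n - z • 1) ⊗ₖ (1 : Matrix (Fin m₃) (Fin m₃) ℂ)) 0 0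
    ((calA n - z • 1) ⊗ₖ (1 : Matrix (Fin m₃) (Fin m₃) ℂ))

/-- `diag {(𝒜^*-zI) ⊗ I_{m₃}, (𝒜^*-zI) ⊗ I_{m₃}}` (the diagonal blocks `E₁₁`, `E₂₂`). -/
def diagKronH (n m₃ : ℕ) (z : ℂ) :
    Matrix ((Fin n × Fin m₃) ⊕ (Fin n × Fin m₃)) ((Fin n × Fin m₃) ⊕ (Fin n × Fin m₃)) ℂ :=
  Matrix.fromBlocks (((calA n)ᴴ - z • 1) ⊗ₖ (1 : Matrix (Fin m₃) (Fin m₃) ℂ)) 0 0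
    (((calA n)ᴴ - z • 1) ⊗ₖ (1 : Matrix (Fin m₃) (Fin m₃) ℂ))

/-- `𝔄(z) = diag {(𝒜^*-zI) ⊗ I_{m₃}, (𝒜-zI) ⊗ I_{m₃}}`. -/
def frakA (n m₃ : ℕ) (z : ℂ) :
    Matrix ((Fin n × Fin m₃) ⊕ (Fin n × Fin m₃)) ((Fin n × Fin m₃) ⊕ (Fin n × Fin m₃)) ℂ :=
  Matrix.fromBlocks (((calA n)ᴴ - z • 1) ⊗ₖ (1 : Matrix (Fin m₃) (Fin m₃) ℂ)) 0 0
    ((calA n - z • 1) ⊗ₖ (1 : Matrix (Fin m₃) (Fin m₃) ℂ))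

/-- `G₁₂ = i (Π̂₁ Γ₂ - [[ℒ₂ℒ₁^*, 0], [K₁₂, 0]])`. -/
def G12 (m₁ m₂ m₃ : ℕ) (t : ℤ → ℤ → Matrix (Fin m₃) (Fin m₃) ℂ) :
    Matrix ((Fin m₂ × Fin m₃) ⊕ (Fin m₂ × Fin m₃)) ((Fin m₁ × Fin m₃) ⊕ (Fin m₁ × Fin m₃)) ℂ :=
  Complex.I • (Pihat1 m₁ m₂ m₃ t * Gamma2 m₁ m₂ m₃ t -
    Matrix.fromBlocks (Lp m₂ m₃ * (Lp m₁ m₃)ᴴ) 0 (K12 m₁ m₂ m₃ t) 0)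

/-- `G₂₁ = i (Π̂₂ Γ₁ - [[ℒ₁ℒ₂^*, 0], [K₁₁, 0]])`. -/
def G21 (m₁ m₂ m₃ : ℕ) (t : ℤ → ℤ → Matrix (Fin m₃) (Fin m₃) ℂ) :
    Matrix ((Fin m₁ × Fin m₃) ⊕ (Fin m₁ × Fin m₃)) ((Fin m₂ × Fin m₃) ⊕ (Fin m₂ × Fin m₃)) ℂ :=
  Complex.I • (Pihat2 m₁ m₂ m₃ t * Gamma1 m₁ m₂ m₃ t -
    Matrix.fromBlocks (Lp m₁ m₃ * (Lp m₂ m₃)ᴴ) 0 (K11 m₁ m₂ m₃ t) 0)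

/-- `G(λ) = [[G₁₁(λ₂), G₁₂], [G₂₁, G₂₂(λ₁)]]`. -/
def Gmat (m₁ m₂ m₃ : ℕ) (t : ℤ → ℤ → Matrix (Fin m₃) (Fin m₃) ℂ) (l₁ l₂ : ℂ) :
    Matrix ((((Fin m₂ × Fin m₃) ⊕ (Fin m₂ × Fin m₃))) ⊕ (((Fin m₁ × Fin m₃) ⊕ (Fin m₁ × Fin m₃))))
      ((((Fin m₂ × Fin m₃) ⊕ (Fin m₂ × Fin m₃))) ⊕ (((Fin m₁ × Fin m₃) ⊕ (Fin m₁ × Fin m₃)))) ℂ :=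
  Matrix.fromBlocks (diagKron m₂ m₃ l₂) (G12 m₁ m₂ m₃ t) (G21 m₁ m₂ m₃ t) (diagKron m₁ m₃ l₁)

/-- `E₁₂ = -i (Π̂₁ Γ₂ - [[0, 0], [K₁₂, ℒ₂ℒ₁^*]])`. -/
def E12m (m₁ m₂ m₃ : ℕ) (t : ℤ → ℤ → Matrix (Fin m₃) (Fin m₃) ℂ) :
    Matrix ((Fin m₂ × Fin m₃) ⊕ (Fin m₂ × Fin m₃)) ((Fin m₁ × Fin m₃) ⊕ (Fin m₁ × Fin m₃)) ℂ :=
  (-Complex.I) • (Pihat1 m₁ m₂ m₃ t * Gamma2 m₁ m₂ m₃ t -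
    Matrix.fromBlocks 0 0 (K12 m₁ m₂ m₃ t) (Lp m₂ m₃ * (Lp m₁ m₃)ᴴ))

/-- `E₂₁ = -i (Π̂₂ Γ₁ - [[0, 0], [K₁₁, ℒ₁ℒ₂^*]])`. -/
def E21m (m₁ m₂ m₃ : ℕ) (t : ℤ → ℤ → Matrix (Fin m₃) (Fin m₃) ℂ) :
    Matrix ((Fin m₁ × Fin m₃) ⊕ (Fin m₁ × Fin m₃)) ((Fin m₂ × Fin m₃) ⊕ (Fin m₂ × Fin m₃)) ℂ :=
  (-Complex.I) • (Pihat2 m₁ m₂ m₃ t * Gamma1 m₁ m₂ m₃ t -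
    Matrix.fromBlocks 0 0 (K11 m₁ m₂ m₃ t) (Lp m₁ m₃ * (Lp m₂ m₃)ᴴ))

/-- `E(μ) = [[E₁₁(μ₂), E₁₂], [E₂₁, E₂₂(μ₁)]]`. -/
def Emat (m₁ m₂ m₃ : ℕ) (t : ℤ → ℤ → Matrix (Fin m₃) (Fin m₃) ℂ) (mu₁ mu₂ : ℂ) :
    Matrix ((((Fin m₂ × Fin m₃) ⊕ (Fin m₂ × Fin m₃))) ⊕ (((Fin m₁ × Fin m₃) ⊕ (Fin m₁ × Fin m₃))))
      ((((Fin m₂ × Fin m₃) ⊕ (Fin m₂ × Fin m₃))) ⊕ (((Fin m₁ × Fin m₃) ⊕ (Fin m₁ × Fin m₃)))) ℂ :=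
  Matrix.fromBlocks (diagKronH m₂ m₃ mu₂) (E12m m₁ m₂ m₃ t) (E21m m₁ m₂ m₃ t) (diagKronH m₁ m₃ mu₁)

/-- `θ(λ) = i (I_{m₃} + K R (A₁-λ₁I)⁻¹ (A₂-λ₂I)⁻¹ ℒ)`. -/
def theta (m₁ m₂ m₃ : ℕ) (t : ℤ → ℤ → Matrix (Fin m₃) (Fin m₃) ℂ) (l₁ l₂ : ℂ) :
    Matrix (Fin m₃) (Fin m₃) ℂ :=
  Complex.I • (1 + Kmat m₁ m₂ m₃ t * (Tmat m₁ m₂ m₃ t)⁻¹ *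
    (A1 m₁ m₂ m₃ - l₁ • 1)⁻¹ * (A2 m₁ m₂ m₃ - l₂ • 1)⁻¹ * Lmat m₁ m₂ m₃)

/-- `ϑ(μ) = -i (I_{m₃} + ℒ^* (A₁^*-μ₁I)⁻¹ (A₂^*-μ₂I)⁻¹ R N)`. -/
def vartheta (m₁ m₂ m₃ : ℕ) (t : ℤ → ℤ → Matrix (Fin m₃) (Fin m₃) ℂ) (mu₁ mu₂ : ℂ) :
    Matrix (Fin m₃) (Fin m₃) ℂ :=
  (-Complex.I) • (1 + (Lmat m₁ m₂ m₃)ᴴ * ((A1 m₁ m₂ m₃)ᴴ - mu₁ • 1)⁻¹ *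
    ((A2 m₁ m₂ m₃)ᴴ - mu₂ • 1)⁻¹ * (Tmat m₁ m₂ m₃ t)⁻¹ * Nmat m₁ m₂ m₃ t)

/-- The exchange (anti-diagonal) matrix `U_n = {δ_{n-i-k+1}}`. -/
def Up (n : ℕ) : Matrix (Fin n) (Fin n) ℂ :=
  Matrix.of fun i k => if (i : ℕ) + (k : ℕ) + 1 = n then 1 else 0

/-- `U = U₁ ⊗ U₂ ⊗ U₃`. -/
def Umat (m₁ m₂ m₃ : ℕ) : Matrix (Idx m₁ m₂ m₃) (Idx m₁ m₂ m₃) ℂ :=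
  (Up m₁ ⊗ₖ Up m₂) ⊗ₖ Up m₃

/-- `Ũ_k = [[0, -(U_k ⊗ U₃)], [U_k ⊗ U₃, 0]]`. -/
def Utilde (n m₃ : ℕ) :
    Matrix ((Fin n × Fin m₃) ⊕ (Fin n × Fin m₃)) ((Fin n × Fin m₃) ⊕ (Fin n × Fin m₃)) ℂ :=
  Matrix.fromBlocks 0 (-(Up n ⊗ₖ Up m₃)) (Up n ⊗ₖ Up m₃) 0

/-- The DSTU property: `U₃ t_j^{(r)} U₃ = (t_j^{(r)})ᵀ` for all blocks. -/
def DSTU (m₃ : ℕ) (t : ℤ → ℤ → Matrix (Fin m₃) (Fin m₃) ℂ) : Prop :=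
  ∀ r j : ℤ, Up m₃ * t r j * Up m₃ = (t r j)ᵀ

/-- `q(μ) = ((μ₁-i/2)/(μ₁+i/2))^{m₁} ((μ₂-i/2)/(μ₂+i/2))^{m₂}`. -/
def qfun (m₁ m₂ : ℕ) (mu₁ mu₂ : ℂ) : ℂ :=
  ((mu₁ - Complex.I / 2) / (mu₁ + Complex.I / 2)) ^ m₁ *
    ((mu₂ - Complex.I / 2) / (mu₂ + Complex.I / 2)) ^ m₂

theorem Lp_mul_M21 (m₁ m₂ m₃ : ℕ) : (Lp m₂ m₃)ᴴ * M21 m₁ m₂ m₃ = (Lmat m₁ m₂ m₃)ᴴ := by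
  ext l x
  simp only [Matrix.mul_apply, Matrix.conjTranspose_apply, Lp, M21, Lmat, Matrix.of_apply]
  rw [Finset.sum_eq_single (x.1.2, x.2)]
  · simp
  · rintro ⟨a, b⟩ _ h
    have : ¬ (a = x.1.2 ∧ b = x.2) := fun h' => h (Prod.ext h'.1 h'.2)
    simp [this]
  · simp

theorem Lp_mul_M22 (m₁ m₂ m₃ : ℕ) : (Lp m₁ m₃)ᴴ * M22 m₁ m₂ m₃ = (Lmat m₁ m₂ m₃)ᴴ := by
  ext l x
  simp only [Matrix.mul_apply, Matrix.conjTranspose_apply, Lp, M22, Lmat, Matrix.of_apply]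
  rw [Finset.sum_eq_single (x.1.1, x.2)]
  · simp
  · rintro ⟨a, b⟩ _ h
    have : ¬ (a = x.1.1 ∧ b = x.2) := fun h' => h (Prod.ext h'.1 h'.2)
    simp [this]
  · simp

theorem row_mul_Gammahat1 (m₁ m₂ m₃ : ℕ) (t : ℤ → ℤ → Matrix (Fin m₃) (Fin m₃) ℂ) :
    Matrix.fromCols (Lp m₂ m₃)ᴴ (0 : Matrix (Fin m₃) (Fin m₂ × Fin m₃) ℂ) * Gammahat1 m₁ m₂ m₃ t =
      (Lmat m₁ m₂ m₃)ᴴ * (Tmat m₁ m₂ m₃ t)⁻¹ := by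
  rw [Gammahat1, Pihat1, ← Matrix.mul_assoc, Matrix.fromCols_mul_fromRows, Lp_mul_M21,
    Matrix.zero_mul, add_zero]

theorem row_mul_Gammahat2 (m₁ m₂ m₃ : ℕ) (t : ℤ → ℤ → Matrix (Fin m₃) (Fin m₃) ℂ) :
    Matrix.fromCols (-(Lp m₁ m₃)ᴴ) (0 : Matrix (Fin m₃) (Fin m₁ × Fin m₃) ℂ) *
      Gammahat2 m₁ m₂ m₃ t = -((Lmat m₁ m₂ m₃)ᴴ * (Tmat m₁ m₂ m₃ t)⁻¹) := by
  rw [Gammahat2, Pihat2, ← Matrix.mul_assoc, Matrix.fromCols_mul_fromRows, Matrix.neg_mul,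
    Lp_mul_M22, Matrix.zero_mul, add_zero, Matrix.neg_mul]

/-- `ℒ̂^* Γ̂ = 0` and consequently `ℒ̂^* û(λ) = 0`,
where `ℒ̂ = col[ℒ₂; 0; -ℒ₁; 0]`, `Γ̂ = col[Γ̂₁; Γ̂₂]`, `û = col[û₁; û₂]`. -/
theorem statement12 (m₁ m₂ m₃ : ℕ) (hm₁ : 2 ≤ m₁) (hm₂ : 2 ≤ m₂) (hm₃ : 2 ≤ m₃)
    (t : ℤ → ℤ → Matrix (Fin m₃) (Fin m₃) ℂ) (hT : IsUnit (Tmat m₁ m₂ m₃ t))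
    (l₁ l₂ : ℂ) (hl₁ : l₁ ≠ Complex.I / 2) (hl₂ : l₂ ≠ Complex.I / 2) :
    (Matrix.fromRows (Matrix.fromRows (Lp m₂ m₃) (0 : Matrix (Fin m₂ × Fin m₃) (Fin m₃) ℂ))
      (Matrix.fromRows (-(Lp m₁ m₃)) (0 : Matrix (Fin m₁ × Fin m₃) (Fin m₃) ℂ)))ᴴ *
      Matrix.fromRows (Gammahat1 m₁ m₂ m₃ t) (Gammahat2 m₁ m₂ m₃ t) = 0 ∧
    (Matrix.fromRows (Matrix.fromRows (Lp m₂ m₃) (0 : Matrix (Fin m₂ × Fin m₃) (Fin m₃) ℂ))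
      (Matrix.fromRows (-(Lp m₁ m₃)) (0 : Matrix (Fin m₁ × Fin m₃) (Fin m₃) ℂ)))ᴴ *
      Matrix.fromRows (uhat1 m₁ m₂ m₃ t l₁ l₂) (uhat2 m₁ m₂ m₃ t l₁ l₂) = 0 := by
  simp only [Matrix.conjTranspose_fromRows_eq_fromCols_conjTranspose, Matrix.conjTranspose_zero,
    Matrix.conjTranspose_neg, Matrix.fromCols_mul_fromRows]
  refine ⟨?_, ?_⟩
  · rw [row_mul_Gammahat1, row_mul_Gammahat2, add_neg_cancel]
  · simp only [uhat1, uhat2, vhat1, vhat2, Matrix.mul_add, Matrix.mul_smul,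
      Matrix.fromCols_mul_fromRows, ← Matrix.mul_assoc, row_mul_Gammahat1, row_mul_Gammahat2,
      Matrix.mul_zero, Matrix.zero_mul, add_zero, smul_zero, Matrix.neg_mul, add_neg_cancel]

end TBT
end
end

section
/- (Theorem 3.1) Let T be an invertible block TBT-matrix and λ = (λ₁,λ₂) with λ₁,λ₂ ∉ {i/2, −i/2}. Then G(λ)û(λ) = col[0; ℒ₂; 0; ℒ₁]·θ(λ), where û(λ) = col[û₁(λ); û₂(λ)] and θ(λ) = i(I_{m₃} + K R (A₁−λ₁I)^{−1}(A₂−λ₂I)^{−1}ℒ). In particular, if G(λ) is invertible then û(λ) = G(λ)^{−1} col[0; 1_{m₂}⊗I_{m₃}; 0; 1_{m₁}⊗I_{m₃}]·θ(λ). -/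
open Matrix Kronecker BigOperators

noncomputable section

namespace TBT

lemma sub_kron {a b c d : Type*} (X Y : Matrix a b ℂ) (Z : Matrix c d ℂ) :
    (X - Y) ⊗ₖ Z = X ⊗ₖ Z - Y ⊗ₖ Z := by
  ext; simp [Matrix.kroneckerMap_apply, sub_mul]

lemma kron_sub {a b c d : Type*} (X Y : Matrix a b ℂ) (Z : Matrix c d ℂ) :
    Z ⊗ₖ (X - Y) = Z ⊗ₖ X - Z ⊗ₖ Y := by
  ext; simp [Matrix.kroneckerMap_apply, mul_sub]

lemma sc_nat (f : ℤ → ℂ) (k i : ℕ) :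
    (∑ l ∈ Finset.range i, f ((l:ℤ) - k)) + (∑ l ∈ Finset.range k, f ((i:ℤ) - l)) + f ((i:ℤ) - k)
      = f 0 + (∑ s ∈ Finset.range i, f ((s:ℤ)+1)) + ∑ s ∈ Finset.range k, f (-((s:ℤ)+1)) := by
  induction i with
  | zero =>
    have h := Finset.sum_range_succ (fun l : ℕ => f (-(l:ℤ))) k
    rw [Finset.sum_range_succ'] at h
    simp at h ⊢
    rw [← h]; ring
  | succ i ih =>
    have h := Finset.sum_range_succ (fun l : ℕ => f (((i+1:ℕ):ℤ) - l)) k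
    rw [Finset.sum_range_succ'] at h
    rw [Finset.sum_range_succ, Finset.sum_range_succ]
    have e : ∀ l : ℕ, (((i+1:ℕ):ℤ) - ((l+1:ℕ):ℤ)) = (i:ℤ) - l := by intro l; push_cast; ring
    simp only [e] at h
    have e2 : (((i+1:ℕ):ℤ) - ((0:ℕ):ℤ)) = (i:ℤ)+1 := by push_cast; ring
    rw [e2] at h
    linear_combination ih - h

lemma calA_sum (n : ℕ) (i : Fin n) (g : ℕ → ℂ) :
    ∑ l : Fin n, calA n i l * g l =
      Complex.I * ((2:ℂ)⁻¹ * g i + ∑ l ∈ Finset.range (i:ℕ), g l) := by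
  have h1 : ∀ l : Fin n, calA n i l * g l =
      (fun l : ℕ => Complex.I * ((if l = (i:ℕ) then (2:ℂ)⁻¹ * g l else 0) +
        (if l < (i:ℕ) then g l else 0))) (l:ℕ) := by
    intro l
    simp only [calA, aEnt, Matrix.of_apply]
    rcases lt_trichotomy (l:ℕ) (i:ℕ) with h | h | h
    · have a1 : ¬ (((i:ℕ):ℤ) - ((l:ℕ):ℤ) < 0) := by omega
      have a2 : ¬ (((i:ℕ):ℤ) - ((l:ℕ):ℤ) = 0) := by omega
      simp [a1, a2, h, h.ne]
    · simp [h]; ring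
    · have a1 : (((i:ℕ):ℤ) - ((l:ℕ):ℤ) < 0) := by omega
      have a2 : ¬ ((l:ℕ) < (i:ℕ)) := by omega
      have a3 : ¬ ((l:ℕ) = (i:ℕ)) := by omega
      rw [if_pos a1, if_neg a2, if_neg a3]; ring
  rw [Finset.sum_congr rfl (fun l _ => h1 l), Fin.sum_univ_eq_sum_range (fun l : ℕ => Complex.I * ((if l = (i:ℕ) then (2:ℂ)⁻¹ * g l else 0) +
        (if l < (i:ℕ) then g l else 0))) n, ← Finset.mul_sum, Finset.sum_add_distrib]
  congr 2
  · simp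
  · rw [← Finset.sum_filter]
    congr 1
    ext l; simp only [Finset.mem_filter, Finset.mem_range]; have := i.2; omega

lemma calA_star (n : ℕ) (i l : Fin n) : star (calA n i l) = - calA n i l := by
  simp only [calA, aEnt, Matrix.of_apply]
  split_ifs <;> simp
  ring

lemma sc (n : ℕ) (f : ℤ → ℂ) (i k : Fin n) :
    ∑ l : Fin n, calA n i l * f (((l:ℕ):ℤ) - ((k:ℕ):ℤ)) -
      ∑ l : Fin n, f (((i:ℕ):ℤ) - ((l:ℕ):ℤ)) * star (calA n k l) =
    Complex.I * (((2:ℂ)⁻¹ * f 0 + ∑ s ∈ Finset.range (i:ℕ), f ((s:ℤ)+1)) +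
      ((2:ℂ)⁻¹ * f 0 + ∑ s ∈ Finset.range (k:ℕ), f (-((s:ℤ)+1)))) := by
  have h2 : ∀ l : Fin n, f (((i:ℕ):ℤ) - ((l:ℕ):ℤ)) * star (calA n k l) =
     - (calA n k l * (fun l : ℕ => f (((i:ℕ):ℤ) - (l:ℤ))) (l:ℕ)) := by
    intro l; rw [calA_star]; ring
  rw [Finset.sum_congr rfl (fun l _ => h2 l), Finset.sum_neg_distrib,
    calA_sum n k (fun l : ℕ => f (((i:ℕ):ℤ) - (l:ℤ))),
    calA_sum n i (fun l : ℕ => f ((l:ℤ) - ((k:ℕ):ℤ)))]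
  linear_combination Complex.I * sc_nat f k i

section helpers

variable (m₁ m₂ m₃ : ℕ)

lemma A1_mul {κ : Type*} (X : Matrix (Idx m₁ m₂ m₃) κ ℂ) (a b c k) :
    (A1 m₁ m₂ m₃ * X) ((a,b),c) k = ∑ l, calA m₁ a l * X ((l,b),c) k := by
  simp [A1, Matrix.mul_apply, Fintype.sum_prod_type, Matrix.kroneckerMap_apply, Matrix.one_apply]

lemma A2_mul {κ : Type*} (X : Matrix (Idx m₁ m₂ m₃) κ ℂ) (a b c k) :
    (A2 m₁ m₂ m₃ * X) ((a,b),c) k = ∑ l, calA m₂ b l * X ((a,l),c) k := by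
  simp [A2, Matrix.mul_apply, Fintype.sum_prod_type, Matrix.kroneckerMap_apply, Matrix.one_apply, Finset.sum_comm]

lemma mul_A1H {κ : Type*} (X : Matrix κ (Idx m₁ m₂ m₃) ℂ) (a b c k) :
    (X * (A1 m₁ m₂ m₃)ᴴ) k ((a,b),c) = ∑ l, X k ((l,b),c) * star (calA m₁ a l) := by
  simp [A1, Matrix.mul_apply, Fintype.sum_prod_type, Matrix.kroneckerMap_apply, Matrix.one_apply, apply_ite]

lemma mul_A2H {κ : Type*} (X : Matrix κ (Idx m₁ m₂ m₃) ℂ) (a b c k) :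
    (X * (A2 m₁ m₂ m₃)ᴴ) k ((a,b),c) = ∑ l, X k ((a,l),c) * star (calA m₂ b l) := by
  simp [A2, Matrix.mul_apply, Fintype.sum_prod_type, Matrix.kroneckerMap_apply, Matrix.one_apply, apply_ite, ite_and]

/-- `B = 𝒜 ⊗ I`. -/
def Bm (n m₃ : ℕ) : Matrix (Fin n × Fin m₃) (Fin n × Fin m₃) ℂ :=
  calA n ⊗ₖ (1 : Matrix (Fin m₃) (Fin m₃) ℂ)

lemma Bm_sub (n : ℕ) (z : ℂ) : (calA n - z • 1) ⊗ₖ (1 : Matrix (Fin m₃) (Fin m₃) ℂ) =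
    Bm n m₃ - z • 1 := by
  rw [Bm, sub_kron, Matrix.smul_kronecker, Matrix.one_kronecker_one]

lemma Bm_mul {κ : Type*} (n : ℕ) (X : Matrix (Fin n × Fin m₃) κ ℂ) (a c k) :
    (Bm n m₃ * X) (a,c) k = ∑ l, calA n a l * X (l,c) k := by
  simp [Bm, Matrix.mul_apply, Fintype.sum_prod_type, Matrix.kroneckerMap_apply, Matrix.one_apply]

lemma calA_unit (n : ℕ) (z : ℂ) (hz : z ≠ Complex.I/2) : IsUnit (calA n - z • 1) := by
  rw [Matrix.isUnit_iff_isUnit_det, Matrix.det_of_isLowerTriangular]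
  · simp [calA, aEnt, isUnit_iff_ne_zero, Finset.prod_ne_zero_iff, sub_eq_zero, hz.symm]
  · intro i j hij
    have h : i < j := hij
    have h' : (((i:ℕ):ℤ) - ((j:ℕ):ℤ) < 0) := by have : (i:ℕ) < j := h
                                                omega
    simp only [calA, aEnt, Matrix.sub_apply, Matrix.smul_apply, Matrix.of_apply, if_pos h', Matrix.one_apply, if_neg h.ne]
    simp

lemma kron_unit {a b : Type*} [Fintype a] [Fintype b] [DecidableEq a] [DecidableEq b]
    {X : Matrix a a ℂ} {Y : Matrix b b ℂ} (hX : IsUnit X) (hY : IsUnit Y) : IsUnit (X ⊗ₖ Y) := by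
  rw [Matrix.isUnit_iff_isUnit_det] at *
  rw [Matrix.det_kronecker]
  exact (hX.pow _).mul (hY.pow _)

lemma A1_unit (z : ℂ) (hz : z ≠ Complex.I/2) : IsUnit (A1 m₁ m₂ m₃ - z • 1) := by
  have : A1 m₁ m₂ m₃ - z • 1 = ((calA m₁ - z • 1) ⊗ₖ (1 : Matrix (Fin m₂) (Fin m₂) ℂ)) ⊗ₖ
      (1 : Matrix (Fin m₃) (Fin m₃) ℂ) := by
    simp [A1, sub_kron, Matrix.smul_kronecker]
  rw [this]
  exact kron_unit (kron_unit (calA_unit _ _ hz) isUnit_one) isUnit_one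

lemma A2_unit (z : ℂ) (hz : z ≠ Complex.I/2) : IsUnit (A2 m₁ m₂ m₃ - z • 1) := by
  have : A2 m₁ m₂ m₃ - z • 1 = ((1 : Matrix (Fin m₁) (Fin m₁) ℂ) ⊗ₖ (calA m₂ - z • 1)) ⊗ₖ
      (1 : Matrix (Fin m₃) (Fin m₃) ℂ) := by
    simp [A2, sub_kron, kron_sub, Matrix.smul_kronecker, Matrix.kronecker_smul]
  rw [this]
  exact kron_unit (kron_unit isUnit_one (calA_unit _ _ hz)) isUnit_one

lemma A12_comm : A1 m₁ m₂ m₃ * A2 m₁ m₂ m₃ = A2 m₁ m₂ m₃ * A1 m₁ m₂ m₃ := by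
  simp [A1, A2, ← Matrix.mul_kronecker_mul]

variable (t : ℤ → ℤ → Matrix (Fin m₃) (Fin m₃) ℂ)

lemma id1 : A1 m₁ m₂ m₃ * Tmat m₁ m₂ m₃ t - Tmat m₁ m₂ m₃ t * (A1 m₁ m₂ m₃)ᴴ =
    Complex.I • (M11 m₁ m₂ m₃ t * M21 m₁ m₂ m₃ + M31 m₁ m₂ m₃ * M41 m₁ m₂ m₃ t) := by
  ext ⟨⟨a,b⟩,c⟩ ⟨⟨a',b'⟩,c'⟩
  rw [Matrix.sub_apply, A1_mul, mul_A1H]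
  refine (sc m₁ (fun r => t r ((b:ℕ) - (b':ℕ) : ℤ) c c') a a').trans ?_
  simp [M11, M21, M31, M41, calT, Matrix.mul_apply, Fintype.sum_prod_type, Matrix.sum_apply, ite_and, apply_ite]

lemma id2 : A2 m₁ m₂ m₃ * Tmat m₁ m₂ m₃ t - Tmat m₁ m₂ m₃ t * (A2 m₁ m₂ m₃)ᴴ =
    Complex.I • (M12 m₁ m₂ m₃ t * M22 m₁ m₂ m₃ + M32 m₁ m₂ m₃ * M42 m₁ m₂ m₃ t) := by
  ext ⟨⟨a,b⟩,c⟩ ⟨⟨a',b'⟩,c'⟩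
  rw [Matrix.sub_apply, A2_mul, mul_A2H]
  refine (sc m₂ (fun r => t ((a:ℕ) - (a':ℕ) : ℤ) r c c') b b').trans ?_
  simp [M12, M22, M32, M42, M12blk, M42blk, Matrix.mul_apply, Fintype.sum_prod_type, Matrix.sum_apply, ite_and, apply_ite]

lemma delta_sum1 (n : ℕ) (x : ℂ) : ∑ s ∈ Finset.range n, (if (s:ℤ)+1 = 0 then x else 0) = 0 :=
  Finset.sum_eq_zero (fun s _ => if_neg (by omega))

lemma delta_sum2 (n : ℕ) (x : ℂ) : ∑ s ∈ Finset.range n, (if -((s:ℤ)+1) = 0 then x else 0) = 0 :=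
  Finset.sum_eq_zero (fun s _ => if_neg (by omega))

lemma mul_M21 {κ : Type*} (X : Matrix κ (Fin m₂ × Fin m₃) ℂ) (k a b c) :
    (X * M21 m₁ m₂ m₃) k ((a,b),c) = X k (b,c) := by
  simp [M21, Matrix.mul_apply, Fintype.sum_prod_type, ite_and]

lemma mul_M22 {κ : Type*} (X : Matrix κ (Fin m₁ × Fin m₃) ℂ) (k a b c) :
    (X * M22 m₁ m₂ m₃) k ((a,b),c) = X k (a,c) := by
  simp [M22, Matrix.mul_apply, Fintype.sum_prod_type, ite_and]

lemma Lp_mul {κ : Type*} (n : ℕ) (X : Matrix (Fin m₃) κ ℂ) (k a c) :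
    (Lp n m₃ * X) (a,c) k = X c k := by
  simp [Lp, Matrix.mul_apply]

lemma LpLp (n n' : ℕ) (a c a' c') :
    (Lp n m₃ * (Lp n' m₃)ᴴ) (a,c) (a',c') = if c = c' then 1 else 0 := by
  rw [Lp_mul]
  simp [Lp, apply_ite, eq_comm]

lemma id3 : Bm m₂ m₃ * M21 m₁ m₂ m₃ - M21 m₁ m₂ m₃ * (A2 m₁ m₂ m₃)ᴴ =
    Complex.I • (Lp m₂ m₃ * (Lp m₁ m₃)ᴴ * M22 m₁ m₂ m₃) := by
  ext ⟨b,c⟩ ⟨⟨a',b'⟩,c'⟩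
  rw [Matrix.sub_apply, Bm_mul, mul_A2H]
  have h := sc m₂ (fun r => if r = 0 then (if c = c' then 1 else 0) else 0) b b'
  simp only [delta_sum1, delta_sum2] at h
  have e : ∀ x y : Fin m₂, (((x:ℕ):ℤ) - ((y:ℕ):ℤ) = 0) ↔ x = y := by
    intro x y; rw [sub_eq_zero, Fin.ext_iff]; omega
  simp only [e] at h
  simp only [M21, Matrix.of_apply, ite_and]
  rw [h]
  rw [Matrix.smul_apply, mul_M22, LpLp]
  split_ifs <;> norm_num

lemma id4 : Bm m₁ m₃ * M22 m₁ m₂ m₃ - M22 m₁ m₂ m₃ * (A1 m₁ m₂ m₃)ᴴ =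
    Complex.I • (Lp m₁ m₃ * (Lp m₂ m₃)ᴴ * M21 m₁ m₂ m₃) := by
  ext ⟨b,c⟩ ⟨⟨a',b'⟩,c'⟩
  rw [Matrix.sub_apply, Bm_mul, mul_A1H]
  have h := sc m₁ (fun r => if r = 0 then (if c = c' then 1 else 0) else 0) b a'
  simp only [delta_sum1, delta_sum2] at h
  have e : ∀ x y : Fin m₁, (((x:ℕ):ℤ) - ((y:ℕ):ℤ) = 0) ↔ x = y := by
    intro x y; rw [sub_eq_zero, Fin.ext_iff]; omega
  simp only [e] at h
  simp only [M22, Matrix.of_apply, ite_and]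
  rw [h]
  rw [Matrix.smul_apply, mul_M21, LpLp]
  split_ifs <;> norm_num

lemma id6 : Bm m₁ m₃ * M42 m₁ m₂ m₃ t - M42 m₁ m₂ m₃ t * (A1 m₁ m₂ m₃)ᴴ =
    Complex.I • (K11 m₁ m₂ m₃ t * M21 m₁ m₂ m₃ + Lp m₁ m₃ * Kmat m₁ m₂ m₃ t) := by
  ext ⟨b,c⟩ ⟨⟨a',b'⟩,c'⟩
  rw [Matrix.sub_apply, Bm_mul, mul_A1H]
  refine (sc m₁ (fun r => M42blk m₂ m₃ t r c (b',c')) b a').trans ?_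
  simp [K11, Kmat, Lp, M21, Matrix.mul_apply, Fintype.sum_prod_type, Matrix.sum_apply, ite_and, apply_ite]

lemma id5 : Bm m₂ m₃ * M41 m₁ m₂ m₃ t - M41 m₁ m₂ m₃ t * (A2 m₁ m₂ m₃)ᴴ =
    Complex.I • (K12 m₁ m₂ m₃ t * M22 m₁ m₂ m₃ + Lp m₂ m₃ * Kmat m₁ m₂ m₃ t) := by
  ext ⟨b,c⟩ ⟨⟨a',b'⟩,c'⟩
  rw [Matrix.sub_apply, Bm_mul, mul_A2H]
  have h := sc m₂ (fun r => 2⁻¹ * t 0 r c c' + ∑ s ∈ Finset.range (a':ℕ), t (-((s:ℤ)+1)) r c c') b b'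
  have e : ∀ x y, M41 m₁ m₂ m₃ t (x, c) ((a',y),c') = 2⁻¹ * t 0 ((x:ℕ)-(y:ℕ)) c c' +
      ∑ s ∈ Finset.range (a':ℕ), t (-((s:ℤ)+1)) ((x:ℕ)-(y:ℕ)) c c' := by
    intro x y; simp [M41, calT, Matrix.sum_apply]
  simp only [e]
  rw [h]
  rw [Matrix.smul_apply, Matrix.add_apply, mul_M22, Lp_mul]
  simp only [K12, Kmat, M12blk, M42blk, Matrix.sum_apply,
    Matrix.add_apply, Matrix.smul_apply, Matrix.of_apply, smul_eq_mul]
  simp only [Finset.sum_add_distrib, mul_add, Finset.mul_sum]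
  rw [Finset.sum_comm (s := Finset.range (b:ℕ)), Finset.sum_comm (s := Finset.range (b':ℕ))]
  ring

lemma M31_mul {κ : Type*} (X : Matrix (Fin m₂ × Fin m₃) κ ℂ) (k a b c) :
    (M31 m₁ m₂ m₃ * X) ((a,b),c) k = X (b,c) k := by
  simp [M31, M21, Matrix.mul_apply, Fintype.sum_prod_type, ite_and, apply_ite]

lemma M32_mul {κ : Type*} (X : Matrix (Fin m₁ × Fin m₃) κ ℂ) (k a b c) :
    (M32 m₁ m₂ m₃ * X) ((a,b),c) k = X (a,c) k := by
  simp [M32, M22, Matrix.mul_apply, Fintype.sum_prod_type, ite_and, apply_ite]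

lemma A1_M32 {κ : Type*} (X : Matrix (Fin m₁ × Fin m₃) κ ℂ) :
    A1 m₁ m₂ m₃ * (M32 m₁ m₂ m₃ * X) = M32 m₁ m₂ m₃ * (Bm m₁ m₃ * X) := by
  ext ⟨⟨a,b⟩,c⟩ k
  rw [A1_mul, M32_mul, Bm_mul]
  simp only [M32_mul]

lemma A2_M31 {κ : Type*} (X : Matrix (Fin m₂ × Fin m₃) κ ℂ) :
    A2 m₁ m₂ m₃ * (M31 m₁ m₂ m₃ * X) = M31 m₁ m₂ m₃ * (Bm m₂ m₃ * X) := by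
  ext ⟨⟨a,b⟩,c⟩ k
  rw [A2_mul, M31_mul, Bm_mul]
  simp only [M31_mul]

lemma M32_Lp : M32 m₁ m₂ m₃ * Lp m₁ m₃ = Lmat m₁ m₂ m₃ := by
  ext ⟨⟨a,b⟩,c⟩ k
  rw [M32_mul]; rfl

lemma M31_Lp : M31 m₁ m₂ m₃ * Lp m₂ m₃ = Lmat m₁ m₂ m₃ := by
  ext ⟨⟨a,b⟩,c⟩ k
  rw [M31_mul]; rfl

/-- `(𝒜-zI)⁻¹ 1 ⊗ I`. -/
def cvec (n m₃ : ℕ) (z : ℂ) : Matrix (Fin n × Fin m₃) (Fin m₃) ℂ :=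
  colKronId m₃ (Matrix.mulVec ((calA n - z • 1)⁻¹) (fun _ : Fin n => (1 : ℂ)))

lemma Bm_cvec (n : ℕ) (z : ℂ) (hz : z ≠ Complex.I/2) :
    (Bm n m₃ - z • 1) * cvec n m₃ z = Lp n m₃ := by
  have h : (calA n - z • 1) *ᵥ (((calA n - z • 1)⁻¹) *ᵥ (fun _ : Fin n => (1 : ℂ))) = fun _ => 1 := by
    rw [Matrix.mulVec_mulVec, Matrix.mul_nonsing_inv _
      ((Matrix.isUnit_iff_isUnit_det _).1 (calA_unit n z hz)), Matrix.one_mulVec]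
  rw [cvec]
  set v := ((calA n - z • 1)⁻¹) *ᵥ (fun _ : Fin n => (1 : ℂ))
  ext ⟨a,c⟩ k
  have h' := congrFun h a
  rw [Matrix.sub_mulVec, Matrix.smul_mulVec, Matrix.one_mulVec] at h'
  simp only [Pi.sub_apply, Pi.smul_apply, smul_eq_mul, Matrix.mulVec, dotProduct] at h'
  rw [Matrix.sub_mul, Matrix.smul_mul, Matrix.one_mul, Matrix.sub_apply, Bm_mul]
  simp only [colKronId, Matrix.of_apply, Matrix.smul_apply, smul_eq_mul, Lp]
  simp only [← mul_assoc]
  by_cases hc : c = k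
  · simpa [hc] using h'
  · simp [hc]

lemma abs_row {ι κ κ' σ : Type*} [Fintype ι] [Fintype κ] [Fintype κ'] [Fintype σ] [DecidableEq ι]
    [DecidableEq κ] [DecidableEq κ']
    (R T A Ah : Matrix ι ι ℂ) (P : Matrix ι κ ℂ) (Q : Matrix κ ι ℂ) (Qo : Matrix κ' ι ℂ)
    (w : Matrix ι σ ℂ) (e : Matrix κ σ ℂ) (e' : Matrix κ' σ ℂ) (B : Matrix κ' κ' ℂ)
    (F : Matrix κ' κ ℂ) (L : Matrix κ' σ ℂ) (K : Matrix σ ι ℂ) (z : ℂ)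
    (hRT : R * T = 1) (hTR : T * R = 1)
    (h1 : A * T - T * Ah = Complex.I • (P * Q))
    (h2 : P * e = Complex.I • ((A - z • 1) * w))
    (h3 : B * Qo - Qo * Ah = Complex.I • (F * Q + L * K))
    (h4 : (B - z • 1) * e' = Complex.I • L) (h5 : F * e = 0) :
    (B - z • 1) * (Qo * R * w + e') + Complex.I • (Qo * (R * P) - F) * (Q * R * w + e) =
      L * (Complex.I • (K * R * w)) + Complex.I • L := by
  have hP : Complex.I • (P * (Q * R * w + e)) = z • w - T * Ah * R * w := by
    rw [Matrix.mul_add, smul_add, h2, smul_smul, Complex.I_mul_I, neg_one_smul]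
    have : Complex.I • (P * (Q * R * w)) = (A * T - T * Ah) * R * w := by
      rw [h1]; simp only [Matrix.smul_mul, Matrix.mul_assoc]
    rw [this, Matrix.sub_mul, Matrix.sub_mul, Matrix.mul_assoc A T R, hTR, Matrix.sub_mul]
    simp only [Matrix.mul_one, Matrix.smul_mul, Matrix.one_mul]
    abel
  have hF : Complex.I • (F * (Q * R * w + e)) = (B * Qo - Qo * Ah) * R * w - L * (Complex.I • (K * R * w)) := by
    rw [h3, Matrix.mul_add, h5, add_zero]
    simp only [Matrix.smul_mul, Matrix.mul_smul, Matrix.add_mul, Matrix.mul_assoc, smul_add]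
    abel
  have hs : Complex.I • (Qo * (R * P) - F) * (Q * R * w + e) =
      Qo * R * (Complex.I • (P * (Q * R * w + e))) - Complex.I • (F * (Q * R * w + e)) := by
    simp only [Matrix.smul_mul, Matrix.mul_smul, Matrix.sub_mul, Matrix.mul_assoc, smul_sub]
  have hc : Qo * R * (T * Ah * R * w) = Qo * Ah * R * w := by
    calc Qo * R * (T * Ah * R * w) = Qo * (R * T) * Ah * R * w := by simp only [Matrix.mul_assoc]
      _ = _ := by rw [hRT, Matrix.mul_one]
  rw [hs, hP, hF, Matrix.mul_add, h4, Matrix.mul_sub, hc]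
  simp only [Matrix.sub_mul, Matrix.smul_mul, Matrix.one_mul, Matrix.mul_smul, Matrix.mul_assoc]
  abel

lemma diagKron_eq (n : ℕ) (z : ℂ) : diagKron n m₃ z =
    Matrix.fromBlocks (Bm n m₃) 0 0 (Bm n m₃) - z • 1 := by
  rw [diagKron, Bm_sub, ← Matrix.fromBlocks_one, Matrix.fromBlocks_smul, sub_eq_add_neg _ (z • _),
    sub_eq_add_neg, Matrix.fromBlocks_neg, Matrix.fromBlocks_add]
  simp

/-- `col[0; ℒ]`. -/
def L0 (n m₃ : ℕ) : Matrix ((Fin n × Fin m₃) ⊕ (Fin n × Fin m₃)) (Fin m₃) ℂ :=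
  Matrix.fromRows 0 (Lp n m₃)

/-- `i col[0; c]`. -/
def e0 (n m₃ : ℕ) (z : ℂ) : Matrix ((Fin n × Fin m₃) ⊕ (Fin n × Fin m₃)) (Fin m₃) ℂ :=
  Complex.I • Matrix.fromRows 0 (cvec n m₃ z)

lemma diag_e (n : ℕ) (z : ℂ) (hz : z ≠ Complex.I/2) :
    diagKron n m₃ z * e0 n m₃ z = Complex.I • L0 n m₃ := by
  rw [diagKron, Bm_sub, e0, L0, Matrix.mul_smul, Matrix.fromBlocks_mul_fromRows, Bm_cvec _ _ _ hz]
  simp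

variable {m₁ m₂ m₃}

lemma nsi {ι : Type*} [Fintype ι] [DecidableEq ι] {X : Matrix ι ι ℂ} (h : IsUnit X) :
    X * X⁻¹ = 1 := Matrix.mul_nonsing_inv _ ((Matrix.isUnit_iff_isUnit_det _).1 h)

lemma nsi' {ι : Type*} [Fintype ι] [DecidableEq ι] {X : Matrix ι ι ℂ} (h : IsUnit X) :
    X⁻¹ * X = 1 := Matrix.nonsing_inv_mul _ ((Matrix.isUnit_iff_isUnit_det _).1 h)

variable (m₁ m₂ m₃)

/-- `w`. -/
def wm (l₁ l₂ : ℂ) : Matrix (Idx m₁ m₂ m₃) (Fin m₃) ℂ :=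
  (A1 m₁ m₂ m₃ - l₁ • 1)⁻¹ * ((A2 m₁ m₂ m₃ - l₂ • 1)⁻¹ * Lmat m₁ m₂ m₃)

lemma A12_comm' (l₁ l₂ : ℂ) : (A1 m₁ m₂ m₃ - l₁ • 1) * (A2 m₁ m₂ m₃ - l₂ • 1) =
    (A2 m₁ m₂ m₃ - l₂ • 1) * (A1 m₁ m₂ m₃ - l₁ • 1) := by
  simp only [Matrix.sub_mul, Matrix.mul_sub, A12_comm, Matrix.smul_mul, Matrix.mul_smul, Matrix.one_mul, Matrix.mul_one,
    smul_sub]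
  rw [smul_comm l₁ l₂]
  abel

lemma w2 (l₁ l₂ : ℂ) (h₁ : l₁ ≠ Complex.I/2) (h₂ : l₂ ≠ Complex.I/2) :
    M31 m₁ m₂ m₃ * cvec m₂ m₃ l₂ = (A1 m₁ m₂ m₃ - l₁ • 1) * wm m₁ m₂ m₃ l₁ l₂ := by
  rw [wm, ← Matrix.mul_assoc, nsi (A1_unit _ _ _ _ h₁), Matrix.one_mul]
  have h : (A2 m₁ m₂ m₃ - l₂ • 1) * (M31 m₁ m₂ m₃ * cvec m₂ m₃ l₂) = Lmat m₁ m₂ m₃ := by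
    rw [← M31_Lp, ← Bm_cvec _ _ _ h₂, Matrix.sub_mul, A2_M31, Matrix.sub_mul, Matrix.mul_sub]
    simp
  rw [← h, ← Matrix.mul_assoc, nsi' (A2_unit _ _ _ _ h₂), Matrix.one_mul]

lemma w1 (l₁ l₂ : ℂ) (h₁ : l₁ ≠ Complex.I/2) (h₂ : l₂ ≠ Complex.I/2) :
    M32 m₁ m₂ m₃ * cvec m₁ m₃ l₁ = (A2 m₁ m₂ m₃ - l₂ • 1) * wm m₁ m₂ m₃ l₁ l₂ := by
  have h : (A1 m₁ m₂ m₃ - l₁ • 1) * (M32 m₁ m₂ m₃ * cvec m₁ m₃ l₁) = Lmat m₁ m₂ m₃ := by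
    rw [← M32_Lp, ← Bm_cvec _ _ _ h₁, Matrix.sub_mul, A1_M32, Matrix.sub_mul, Matrix.mul_sub]
    simp
  have h' : (A1 m₁ m₂ m₃ - l₁ • 1) * ((A2 m₁ m₂ m₃ - l₂ • 1) * wm m₁ m₂ m₃ l₁ l₂) =
      Lmat m₁ m₂ m₃ := by
    rw [← Matrix.mul_assoc, A12_comm', Matrix.mul_assoc, wm, ← Matrix.mul_assoc (A1 _ _ _ - _),
      nsi (A1_unit _ _ _ _ h₁), Matrix.one_mul, ← Matrix.mul_assoc, nsi (A2_unit _ _ _ _ h₂), Matrix.one_mul]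
  have := congrArg ((A1 m₁ m₂ m₃ - l₁ • 1)⁻¹ * ·) (h.trans h'.symm)
  simpa only [← Matrix.mul_assoc, nsi' (A1_unit m₁ m₂ m₃ l₁ h₁), Matrix.one_mul] using this

lemma row1 (l₁ l₂ : ℂ) (h₁ : l₁ ≠ Complex.I/2) (h₂ : l₂ ≠ Complex.I/2)
    (hT : IsUnit (Tmat m₁ m₂ m₃ t)) :
    diagKron m₂ m₃ l₂ * uhat1 m₁ m₂ m₃ t l₁ l₂ + G12 m₁ m₂ m₃ t * uhat2 m₁ m₂ m₃ t l₁ l₂ =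
      L0 m₂ m₃ * theta m₁ m₂ m₃ t l₁ l₂ := by
  have := abs_row (Tmat m₁ m₂ m₃ t)⁻¹ (Tmat m₁ m₂ m₃ t) (A2 m₁ m₂ m₃) (A2 m₁ m₂ m₃)ᴴ
    (Pi2 m₁ m₂ m₃ t) (Pihat2 m₁ m₂ m₃ t) (Pihat1 m₁ m₂ m₃ t) (wm m₁ m₂ m₃ l₁ l₂)
    (e0 m₁ m₃ l₁) (e0 m₂ m₃ l₂)
    (Matrix.fromBlocks (Bm m₂ m₃) 0 0 (Bm m₂ m₃))
    (Matrix.fromBlocks (Lp m₂ m₃ * (Lp m₁ m₃)ᴴ) 0 (K12 m₁ m₂ m₃ t) 0)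
    (L0 m₂ m₃) (Kmat m₁ m₂ m₃ t) l₂ (nsi' hT) (nsi hT)
    (by rw [id2, Pi2, Pihat2, Matrix.fromCols_mul_fromRows])
    (by rw [Pi2, e0, Matrix.mul_smul, Matrix.fromCols_mul_fromRows, Matrix.mul_zero, zero_add, w1 _ _ _ _ _ h₁ h₂])
    (by
      rw [L0, Pihat1, Pihat2, Matrix.fromBlocks_mul_fromRows, Matrix.fromBlocks_mul_fromRows,
        Matrix.fromRows_mul, Matrix.fromRows_mul]
      have h3 := id3 m₁ m₂ m₃
      have h5 := id5 m₁ m₂ m₃ t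
      ext (i | i) j
      · simpa using congrFun (congrFun h3 i) j
      · simpa using congrFun (congrFun h5 i) j)
    (by rw [← diagKron_eq, diag_e _ _ _ h₂])
    (by simp [e0, Matrix.fromBlocks_mul_fromRows])
  rw [← diagKron_eq] at this
  rw [theta, uhat1, uhat2, vhat1, vhat2, Gammahat1, Gammahat2, G12, Gamma2]
  simp only [wm, e0, cvec, ← Matrix.mul_assoc] at this ⊢
  rw [this, smul_add, Matrix.mul_add, add_comm, Matrix.mul_smul _ Complex.I 1, Matrix.mul_one]

lemma row2 (l₁ l₂ : ℂ) (h₁ : l₁ ≠ Complex.I/2) (h₂ : l₂ ≠ Complex.I/2)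
    (hT : IsUnit (Tmat m₁ m₂ m₃ t)) :
    diagKron m₁ m₃ l₁ * uhat2 m₁ m₂ m₃ t l₁ l₂ + G21 m₁ m₂ m₃ t * uhat1 m₁ m₂ m₃ t l₁ l₂ =
      L0 m₁ m₃ * theta m₁ m₂ m₃ t l₁ l₂ := by
  have := abs_row (Tmat m₁ m₂ m₃ t)⁻¹ (Tmat m₁ m₂ m₃ t) (A1 m₁ m₂ m₃) (A1 m₁ m₂ m₃)ᴴ
    (Pi1 m₁ m₂ m₃ t) (Pihat1 m₁ m₂ m₃ t) (Pihat2 m₁ m₂ m₃ t) (wm m₁ m₂ m₃ l₁ l₂)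
    (e0 m₂ m₃ l₂) (e0 m₁ m₃ l₁)
    (Matrix.fromBlocks (Bm m₁ m₃) 0 0 (Bm m₁ m₃))
    (Matrix.fromBlocks (Lp m₁ m₃ * (Lp m₂ m₃)ᴴ) 0 (K11 m₁ m₂ m₃ t) 0)
    (L0 m₁ m₃) (Kmat m₁ m₂ m₃ t) l₁ (nsi' hT) (nsi hT)
    (by rw [id1, Pi1, Pihat1, Matrix.fromCols_mul_fromRows])
    (by rw [Pi1, e0, Matrix.mul_smul, Matrix.fromCols_mul_fromRows, Matrix.mul_zero, zero_add, w2 _ _ _ _ _ h₁ h₂])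
    (by
      rw [L0, Pihat1, Pihat2, Matrix.fromBlocks_mul_fromRows, Matrix.fromBlocks_mul_fromRows,
        Matrix.fromRows_mul, Matrix.fromRows_mul]
      have h3 := id4 m₁ m₂ m₃
      have h5 := id6 m₁ m₂ m₃ t
      ext (i | i) j
      · simpa using congrFun (congrFun h3 i) j
      · simpa using congrFun (congrFun h5 i) j)
    (by rw [← diagKron_eq, diag_e _ _ _ h₁])
    (by simp [e0, Matrix.fromBlocks_mul_fromRows])
  rw [← diagKron_eq] at this
  rw [theta, uhat1, uhat2, vhat1, vhat2, Gammahat1, Gammahat2, G21, Gamma1]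
  simp only [wm, e0, cvec, ← Matrix.mul_assoc] at this ⊢
  rw [this, smul_add, Matrix.mul_add, add_comm, Matrix.mul_smul _ Complex.I 1, Matrix.mul_one]

lemma row12 (l₁ l₂ : ℂ) (h₁ : l₁ ≠ Complex.I/2) (h₂ : l₂ ≠ Complex.I/2)
    (hT : IsUnit (Tmat m₁ m₂ m₃ t))
    (U V : Matrix (((Fin m₂ × Fin m₃) ⊕ (Fin m₂ × Fin m₃)) ⊕ ((Fin m₁ × Fin m₃) ⊕ (Fin m₁ × Fin m₃)))
      (Fin m₃) ℂ)
    (hU : U = Matrix.fromRows (uhat1 m₁ m₂ m₃ t l₁ l₂) (uhat2 m₁ m₂ m₃ t l₁ l₂))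
    (hV : V = Matrix.fromRows (L0 m₂ m₃) (L0 m₁ m₃)) :
    Gmat m₁ m₂ m₃ t l₁ l₂ * U = V * theta m₁ m₂ m₃ t l₁ l₂ ∧
    (IsUnit (Gmat m₁ m₂ m₃ t l₁ l₂) →
      U = (Gmat m₁ m₂ m₃ t l₁ l₂)⁻¹ * (V * theta m₁ m₂ m₃ t l₁ l₂)) := by
  have key : Gmat m₁ m₂ m₃ t l₁ l₂ * U = V * theta m₁ m₂ m₃ t l₁ l₂ := by
    rw [hU, hV, Gmat, Matrix.fromBlocks_mul_fromRows, row1 m₁ m₂ m₃ t l₁ l₂ h₁ h₂ hT,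
      add_comm (G21 m₁ m₂ m₃ t * _), row2 m₁ m₂ m₃ t l₁ l₂ h₁ h₂ hT, Matrix.fromRows_mul]
  refine ⟨key, fun h => ?_⟩
  rw [← key, ← Matrix.mul_assoc, nsi' h, Matrix.one_mul]

end helpers

/-- Theorem 3.1: `G(λ) û(λ) = col[0; ℒ₂; 0; ℒ₁] θ(λ)`, and, if `G(λ)` is
invertible, `û(λ) = G(λ)⁻¹ col[0; 1_{m₂} ⊗ I_{m₃}; 0; 1_{m₁} ⊗ I_{m₃}] θ(λ)`. -/
theorem statement13 (m₁ m₂ m₃ : ℕ) (hm₁ : 2 ≤ m₁) (hm₂ : 2 ≤ m₂) (hm₃ : 2 ≤ m₃)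
    (t : ℤ → ℤ → Matrix (Fin m₃) (Fin m₃) ℂ) (hT : IsUnit (Tmat m₁ m₂ m₃ t))
    (l₁ l₂ : ℂ)
    (hl₁ : l₁ ≠ Complex.I / 2) (hl₁' : l₁ ≠ -(Complex.I / 2))
    (hl₂ : l₂ ≠ Complex.I / 2) (hl₂' : l₂ ≠ -(Complex.I / 2)) :
    Gmat m₁ m₂ m₃ t l₁ l₂ *
        Matrix.fromRows (uhat1 m₁ m₂ m₃ t l₁ l₂) (uhat2 m₁ m₂ m₃ t l₁ l₂) =
      Matrix.fromRows (Matrix.fromRows 0 (Lp m₂ m₃)) (Matrix.fromRows 0 (Lp m₁ m₃)) *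
        theta m₁ m₂ m₃ t l₁ l₂ ∧
    (IsUnit (Gmat m₁ m₂ m₃ t l₁ l₂) →
      Matrix.fromRows (uhat1 m₁ m₂ m₃ t l₁ l₂) (uhat2 m₁ m₂ m₃ t l₁ l₂) =
        (Gmat m₁ m₂ m₃ t l₁ l₂)⁻¹ *
          (Matrix.fromRows (Matrix.fromRows 0 (Lp m₂ m₃)) (Matrix.fromRows 0 (Lp m₁ m₃)) *
            theta m₁ m₂ m₃ t l₁ l₂)) := by
  exact row12 m₁ m₂ m₃ t l₁ l₂ hl₁ hl₂ hT _ _ rfl rfl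

end TBT
end
end
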